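/- Let n ≥ 3 and let C = {(i,j) : 1 ≤ i ≤ j ≤ n}. Then the polytope P^core_DSASM ⊆ ℝ^C, defined as the convex hull of the upper-triangular parts { (x_{i,j})_{(i,j)∈C} : X is an n×n DSASM }, has exactly 2(n−2)² + 3 facets. -/

import Mathlib

/-- An `n × n` alternating sign matrix: entries in `{-1, 0, 1}`, all row- and
column-prefix sums lie in `{0, 1}`, and all full row and column sums equal `1`. -/
def IsASM (n : ℕ) (X : Fin n → Fin n → ℝ) : Prop :=
  (∀ i j, X i j = -1 ∨ X i j = 0 ∨ X i j = 1) ∧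
  (∀ i j, (∑ j' ∈ Finset.Iic j, X i j') = 0 ∨ (∑ j' ∈ Finset.Iic j, X i j') = 1) ∧
  (∀ i j, (∑ i' ∈ Finset.Iic i, X i' j) = 0 ∨ (∑ i' ∈ Finset.Iic i, X i' j) = 1) ∧
  (∀ i, (∑ j, X i j) = 1) ∧
  (∀ j, (∑ i, X i j) = 1)

/-- A facet of a polytope `P`: a nonempty convex proper subset of `P` that is an
extreme subset of `P` and whose dimension is one less than that of `P`. -/
def IsFacetOf {E : Type*} [AddCommGroup E] [Module ℝ E] (P F : Set E) : Prop :=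
  F.Nonempty ∧ Convex ℝ F ∧ F ⊂ P ∧ IsExtreme ℝ P F ∧
    Module.finrank ℝ ↥(vectorSpan ℝ F) = Module.finrank ℝ ↥(vectorSpan ℝ P) - 1

section Polyhedron

variable {E : Type*} [AddCommGroup E] [Module ℝ E]

lemma AffineMap.apply_add_smul (g : E →ᵃ[ℝ] ℝ) (p d : E) (t : ℝ) :
    g (p + t • d) = g p + t * g.linear d := by
  have := g.map_vadd p (t • d)
  simp only [vadd_eq_add, map_smul, smul_eq_mul] at this
  rw [add_comm, this, add_comm]

lemma AffineMap.exists_pos_forall_nonneg {K : Type*} [Finite K] (f : K → E →ᵃ[ℝ] ℝ) (p d : E)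
    (h : ∀ k, 0 < f k p ∨ (0 ≤ f k p ∧ (f k).linear d = 0)) :
    ∃ t : ℝ, 0 < t ∧ ∀ k, 0 ≤ f k (p + t • d) := by
  have key : ∀ᶠ t : ℝ in nhdsWithin 0 (Set.Ioi 0), ∀ k, 0 ≤ f k (p + t • d) := by
    rw [Filter.eventually_all]
    intro k
    simp only [AffineMap.apply_add_smul]
    rcases h k with h | ⟨h, h'⟩
    · have hc : Filter.Tendsto (fun t : ℝ => f k p + t * (f k).linear d)
          (nhdsWithin 0 (Set.Ioi 0)) (nhds (f k p + 0 * (f k).linear d)) :=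
        (Continuous.tendsto (by fun_prop) 0).mono_left nhdsWithin_le_nhds
      rw [zero_mul, add_zero] at hc
      exact (hc.eventually (lt_mem_nhds h)).mono fun t ht => ht.le
    · exact Filter.Eventually.of_forall fun t => by simpa [h'] using h
  obtain ⟨t, ht, h0⟩ := (key.and self_mem_nhdsWithin).exists
  exact ⟨t, h0, ht⟩

/-- The polyhedron cut out of an affine subspace by finitely many affine inequalities. -/
def polyhedron {K : Type*} (S : AffineSubspace ℝ E) (f : K → E →ᵃ[ℝ] ℝ) : Set E :=
  {x | x ∈ S ∧ ∀ k, 0 ≤ f k x}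

lemma AffineSubspace.add_smul_mem {S : AffineSubspace ℝ E} {p d : E} (hp : p ∈ S)
    (hd : d ∈ S.direction) (t : ℝ) : p + t • d ∈ S := by
  have := AffineSubspace.vadd_mem_of_mem_direction (S.direction.smul_mem t hd) hp
  rwa [vadd_eq_add, add_comm] at this

variable {K : Type*} {S : AffineSubspace ℝ E} {f : K → E →ᵃ[ℝ] ℝ}

lemma convex_polyhedron : Convex ℝ (polyhedron S f) := by
  have h : polyhedron S f = (S : Set E) ∩ ⋂ k, f k ⁻¹' Set.Ici 0 := by
    ext; simp [polyhedron]
  rw [h]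
  exact S.convex.inter (convex_iInter fun k => (convex_Ici 0).affine_preimage (f k))

lemma exists_forall_pos_of_convex {F : Set E} (hF : Convex ℝ F) (hne : F.Nonempty)
    (hsub : F ⊆ polyhedron S f) (J : Finset K) (hJ : ∀ k ∈ J, ∃ x ∈ F, 0 < f k x) :
    ∃ x ∈ F, ∀ k ∈ J, 0 < f k x := by
  classical
  induction J using Finset.induction_on with
  | empty => exact hne.imp fun x hx => ⟨hx, by simp⟩
  | insert a J _ ih =>
    obtain ⟨x, hx, hxJ⟩ := ih fun k hk => hJ k (Finset.mem_insert_of_mem hk)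
    obtain ⟨y, hy, hya⟩ := hJ a (Finset.mem_insert_self _ _)
    have hval : ∀ k, f k (x + (1 / 2 : ℝ) • (y - x)) = (f k x + f k y) / 2 := by
      intro k
      have := (f k).linearMap_vsub y x
      simp only [vsub_eq_sub] at this
      rw [AffineMap.apply_add_smul, this]
      ring
    refine ⟨x + (1 / 2 : ℝ) • (y - x), hF.add_smul_sub_mem hx hy (by norm_num), ?_⟩
    intro k hk
    rw [hval]
    have hx0 := (hsub hx).2 k
    have hy0 := (hsub hy).2 k
    rcases Finset.mem_insert.1 hk with rfl | hk
    · linarith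
    · linarith [hxJ k hk]

lemma IsExtreme.mem_of_pos [Finite K] {F : Set E} (hF : IsExtreme ℝ (polyhedron S f) F)
    {x y : E} (hx : x ∈ F) (hy : y ∈ polyhedron S f)
    (h : ∀ k, 0 < f k x ∨ f k x = 0 ∧ f k y = 0) : y ∈ F := by
  have hxP := hF.subset hx
  obtain ⟨t, ht, hk⟩ := AffineMap.exists_pos_forall_nonneg f x (x - y) fun k => by
    refine (h k).imp_right fun h => ⟨h.1.ge, ?_⟩
    have := (f k).linearMap_vsub x y
    simpa [h.1, h.2] using this
  refine hF.left_mem_of_mem_openSegment hy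
    (y := x + t • (x - y)) ⟨AffineSubspace.add_smul_mem hxP.1 ?_ t, hk⟩ hx ?_
  · exact AffineSubspace.vsub_mem_direction hxP.1 hy.1
  · refine ⟨t / (1 + t), 1 / (1 + t), by positivity, by positivity, by field_simp; ring, ?_⟩
    have h1 : t / (1 + t) = 1 - 1 / (1 + t) := by field_simp; ring
    have h2 : 1 / (1 + t) * t = 1 - 1 / (1 + t) := by field_simp; ring
    rw [smul_add, smul_smul, h2, h1]
    module

lemma vectorSpan_le_direction {F : Set E} (hF : F ⊆ S) : vectorSpan ℝ F ≤ S.direction := by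
  rw [AffineSubspace.direction]
  exact vectorSpan_mono ℝ hF

lemma vectorSpan_le_ker {F : Set E} {g : E →ᵃ[ℝ] ℝ} (hF : ∀ x ∈ F, g x = 0) :
    vectorSpan ℝ F ≤ LinearMap.ker g.linear := by
  rw [vectorSpan_def, Submodule.span_le]
  rintro _ ⟨x, hx, y, hy, rfl⟩
  change g.linear (x -ᵥ y) = 0
  rw [g.linearMap_vsub, hF x hx, hF y hy, vsub_self]

lemma mem_vectorSpan_of_add_smul_mem {F : Set E} {p d : E} {t : ℝ} (ht : 0 < t) (hp : p ∈ F)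
    (h : p + t • d ∈ F) : d ∈ vectorSpan ℝ F := by
  have := (vectorSpan ℝ F).smul_mem t⁻¹ (vsub_mem_vectorSpan ℝ h hp)
  simpa [smul_smul, ht.ne'] using this

lemma exists_mem_forall_pos {o : E} (ho : o ∈ S) (hof : ∀ k, 0 < f k o) {k : K}
    (hq : ∃ q ∈ S, f k q < 0 ∧ ∀ j, j ≠ k → 0 ≤ f j q) :
    ∃ p ∈ S, f k p = 0 ∧ ∀ j, j ≠ k → 0 < f j p := by
  obtain ⟨q, hqS, hqk, hqj⟩ := hq
  have hok := hof k
  set t := f k o / (f k o - f k q) with ht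
  have hd : 0 < f k o - f k q := by linarith
  have ht0 : 0 < t := by positivity
  have ht1 : t < 1 := by rw [ht, div_lt_one hd]; linarith
  have hval : ∀ j, f j (o + t • (q - o)) = (1 - t) * f j o + t * f j q := by
    intro j
    have := (f j).linearMap_vsub q o
    simp only [vsub_eq_sub] at this
    rw [AffineMap.apply_add_smul, this]
    ring
  refine ⟨o + t • (q - o),
    AffineSubspace.add_smul_mem ho (AffineSubspace.vsub_mem_direction hqS ho) t, ?_, ?_⟩
  · rw [hval, ht]
    field_simp
    ring
  · intro j hj
    rw [hval]
    have h1 : 0 < (1 - t) * f j o := mul_pos (by linarith) (hof j)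
    have h2 : 0 ≤ t * f j q := mul_nonneg ht0.le (hqj j hj)
    linarith

/-- The face of a polyhedron on which one of the inequalities is tight. -/
def polyhedronFace (S : AffineSubspace ℝ E) (f : K → E →ᵃ[ℝ] ℝ) (k : K) : Set E :=
  {x | x ∈ polyhedron S f ∧ f k x = 0}

lemma isExtreme_polyhedronFace (k : K) :
    IsExtreme ℝ (polyhedron S f) (polyhedronFace S f k) := by
  refine ⟨fun x hx => hx.1, fun x hx y hy z hz hzxy => ⟨hx, ?_⟩⟩
  obtain ⟨a, b, ha, hb, hab, rfl⟩ := hzxy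
  have hz0 := hz.2
  rw [Convex.combo_affine_apply hab, smul_eq_mul, smul_eq_mul] at hz0
  have hx0 := hx.2 k
  have := mul_nonneg hb.le (hy.2 k)
  have h0 : a * f k x = 0 := le_antisymm (by linarith) (mul_nonneg ha.le hx0)
  exact (mul_eq_zero.1 h0).resolve_left ha.ne'

lemma convex_polyhedronFace (k : K) : Convex ℝ (polyhedronFace S f k) := by
  have : polyhedronFace S f k = polyhedron S f ∩ f k ⁻¹' {0} := rfl
  rw [this]
  exact convex_polyhedron.inter ((convex_singleton 0).affine_preimage (f k))

lemma vectorSpan_polyhedron [Finite K] {o : E} (ho : o ∈ S) (hof : ∀ k, 0 < f k o) :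
    vectorSpan ℝ (polyhedron S f) = S.direction := by
  refine le_antisymm (vectorSpan_le_direction fun x hx => hx.1) fun d hd => ?_
  obtain ⟨t, ht, h⟩ := AffineMap.exists_pos_forall_nonneg f o d fun k => Or.inl (hof k)
  exact mem_vectorSpan_of_add_smul_mem ht ⟨ho, fun k => (hof k).le⟩
    ⟨AffineSubspace.add_smul_mem ho hd t, h⟩

lemma vectorSpan_polyhedronFace [Finite K] {k : K} {p : E} (hp : p ∈ S) (hpk : f k p = 0)
    (hpj : ∀ j, j ≠ k → 0 < f j p) :
    vectorSpan ℝ (polyhedronFace S f k) = S.direction ⊓ LinearMap.ker (f k).linear := by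
  refine le_antisymm (le_inf (vectorSpan_le_direction fun x hx => hx.1.1)
    (vectorSpan_le_ker fun x hx => hx.2)) fun d hd => ?_
  have hdk : (f k).linear d = 0 := hd.2
  have h0 : ∀ j, 0 ≤ f j p := fun j => by
    by_cases hj : j = k
    · rw [hj, hpk]
    · exact (hpj j hj).le
  obtain ⟨t, ht, h⟩ := AffineMap.exists_pos_forall_nonneg f p d fun j => by
    by_cases hj : j = k
    · subst hj
      exact Or.inr ⟨h0 j, hdk⟩
    · exact Or.inl (hpj j hj)
  refine mem_vectorSpan_of_add_smul_mem ht ⟨⟨hp, h0⟩, hpk⟩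
    ⟨⟨AffineSubspace.add_smul_mem hp hd.1 t, h⟩, ?_⟩
  rw [AffineMap.apply_add_smul, hpk, hdk]
  simp

lemma Submodule.finrank_inf_ker_add_one [FiniteDimensional ℝ E] {D : Submodule ℝ E}
    {g : E →ₗ[ℝ] ℝ} {d : E} (hd : d ∈ D) (hg : g d ≠ 0) :
    Module.finrank ℝ ↥(D ⊓ LinearMap.ker g) + 1 = Module.finrank ℝ D := by
  have h0 : g.domRestrict D ≠ 0 := fun h => hg (by simpa using DFunLike.congr_fun h ⟨d, hd⟩)
  have hker : (LinearMap.ker (g.domRestrict D)).map D.subtype = D ⊓ LinearMap.ker g := by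
    ext x
    simp [and_comm]
  rw [← Module.Dual.finrank_ker_add_one_of_ne_zero (f := g.domRestrict D) h0, ← hker,
    Submodule.finrank_map_subtype_eq]

/-- The facets of a full-dimensional irredundantly described polyhedron correspond bijectively
to its defining inequalities. -/
theorem ncard_facets_polyhedron [FiniteDimensional ℝ E] [Finite K] {o : E} (ho : o ∈ S)
    (hof : ∀ k, 0 < f k o)
    (hq : ∀ k, ∃ q ∈ S, f k q < 0 ∧ ∀ j, j ≠ k → 0 ≤ f j q) :
    {F : Set E | IsFacetOf (polyhedron S f) F}.ncard = Nat.card K := by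
  classical
  have := Fintype.ofFinite K
  choose p hpS hpk hpj using fun k => exists_mem_forall_pos ho hof (hq k)
  have hmem : ∀ k, p k ∈ polyhedronFace S f k := fun k => by
    refine ⟨⟨hpS k, fun j => ?_⟩, hpk k⟩
    by_cases hj : j = k
    · rw [hj, hpk]
    · exact (hpj k j hj).le
  have hoP : o ∈ polyhedron S f := ⟨ho, fun k => (hof k).le⟩
  have hdim : ∀ k, Module.finrank ℝ (vectorSpan ℝ (polyhedronFace S f k)) + 1 =
      Module.finrank ℝ (vectorSpan ℝ (polyhedron S f)) := fun k => by
    rw [vectorSpan_polyhedronFace (hpS k) (hpk k) (hpj k), vectorSpan_polyhedron ho hof]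
    refine Submodule.finrank_inf_ker_add_one
      (AffineSubspace.vsub_mem_direction ho (hpS k)) ?_
    rw [AffineMap.linearMap_vsub, hpk]
    simpa using (hof k).ne'
  have hinj : Function.Injective (polyhedronFace S f) := fun k j h => by
    by_contra hkj
    have h1 : p k ∈ polyhedronFace S f j := h ▸ hmem k
    exact (hpj k j (Ne.symm hkj)).ne' h1.2
  have hset : {F : Set E | IsFacetOf (polyhedron S f) F} = Set.range (polyhedronFace S f) := by
    ext F
    constructor
    · rintro ⟨hne, hconv, hss, hext, hrank⟩
      obtain ⟨k, hk⟩ : ∃ k, ∀ x ∈ F, f k x = 0 := by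
        by_contra! hcon
        obtain ⟨x, hx, hpos⟩ := exists_forall_pos_of_convex hconv hne hss.1 Finset.univ
          fun k _ => (hcon k).imp fun x hx =>
            ⟨hx.1, lt_of_le_of_ne ((hss.1 hx.1).2 k) (Ne.symm hx.2)⟩
        exact hss.2 fun y hy =>
          hext.mem_of_pos hx hy fun k => Or.inl (hpos k (Finset.mem_univ k))
      refine ⟨k, ?_⟩
      have hsub : F ⊆ polyhedronFace S f k := fun x hx => ⟨hss.1 hx, hk x hx⟩
      refine Set.Subset.antisymm (fun y hy => ?_) hsub
      have hcon : ∀ j ∈ Finset.univ.erase k, ∃ x ∈ F, 0 < f j x := by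
        intro j hj
        by_contra! hj0
        have hjF : ∀ x ∈ F, f j x = 0 := fun x hx => le_antisymm (hj0 x hx) ((hss.1 hx).2 j)
        obtain ⟨y, hy⟩ := hne
        have hlt : vectorSpan ℝ F < vectorSpan ℝ (polyhedronFace S f k) := by
          refine lt_of_le_of_ne (vectorSpan_mono ℝ hsub) fun heq => ?_
          have h1 : p k -ᵥ y ∈ vectorSpan ℝ F :=
            heq ▸ vsub_mem_vectorSpan ℝ (hmem k) (hsub hy)
          have h2 : (f j).linear (p k -ᵥ y) = 0 := vectorSpan_le_ker hjF h1
          rw [AffineMap.linearMap_vsub, hjF y hy] at h2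
          exact (hpj k j (Finset.ne_of_mem_erase hj)).ne' (by simpa using h2)
        have h3 := Submodule.finrank_lt_finrank_of_lt hlt
        have h4 := hdim k
        omega
      obtain ⟨x, hx, hpos⟩ := exists_forall_pos_of_convex hconv hne hss.1 _ hcon
      refine hext.mem_of_pos hx hy.1 fun j => ?_
      by_cases hj : j = k
      · subst hj
        exact Or.inr ⟨hk x hx, hy.2⟩
      · exact Or.inl (hpos j (Finset.mem_erase.2 ⟨hj, Finset.mem_univ j⟩))
    · rintro ⟨k, rfl⟩
      refine ⟨⟨p k, hmem k⟩, convex_polyhedronFace k, ⟨fun x hx => hx.1, fun h => ?_⟩,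
        isExtreme_polyhedronFace k, by have := hdim k; omega⟩
      exact (hof k).ne' (h hoP).2
  rw [hset, ← Set.image_univ, Set.ncard_image_of_injective _ hinj, Set.ncard_univ]

end Polyhedron

section CornerSums

/-- The boundary conditions and symmetry of the corner-sum function of a symmetric `n × n` matrix
with unit row sums. -/
structure IsSymmCornerSum {R : Type*} [AddMonoidWithOne R] (n : ℕ) (s : ℕ → ℕ → R) : Prop where
  symm : ∀ a b, s a b = s b a
  zero : ∀ b, s 0 b = 0
  boundary : ∀ a, a ≤ n → s a n = a

/-- The pairs `(i, b)` for which nonnegativity of the sum of the first `b` entries of row `i`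
is an irredundant inequality (rows are indexed from `0`). -/
def lowerIndex (n : ℕ) : Finset (ℕ × ℕ) :=
  insert (0, 1) (Finset.Icc 1 (n - 2) ×ˢ Finset.Icc 1 (n - 2))

/-- The pairs `(i, b)` for which the upper bound `1` on the sum of the first `b` entries of row `i`
is an irredundant inequality (rows are indexed from `0`). -/
def upperIndex (n : ℕ) : Finset (ℕ × ℕ) :=
  insert (0, n - 1) (insert (n - 1, n - 1) (Finset.Icc 1 (n - 2) ×ˢ Finset.Icc 2 (n - 1)))

lemma mem_lowerIndex {n i b : ℕ} : (i, b) ∈ lowerIndex n ↔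
    i = 0 ∧ b = 1 ∨ (1 ≤ i ∧ i ≤ n - 2) ∧ 1 ≤ b ∧ b ≤ n - 2 := by
  simp [lowerIndex]

lemma mem_upperIndex {n i b : ℕ} : (i, b) ∈ upperIndex n ↔
    i = 0 ∧ b = n - 1 ∨ i = n - 1 ∧ b = n - 1 ∨ (1 ≤ i ∧ i ≤ n - 2) ∧ 2 ≤ b ∧ b ≤ n - 1 := by
  simp [upperIndex]

lemma card_lowerIndex (n : ℕ) : (lowerIndex n).card = (n - 2) ^ 2 + 1 := by
  rw [lowerIndex, Finset.card_insert_of_notMem (by simp)]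
  simp [sq]

lemma card_upperIndex {n : ℕ} (hn : 3 ≤ n) : (upperIndex n).card = (n - 2) ^ 2 + 2 := by
  rw [upperIndex, Finset.card_insert_of_notMem (by simp; omega),
    Finset.card_insert_of_notMem (by simp; omega)]
  simp only [Finset.card_product, Nat.card_Icc, sq]
  rw [show n - 1 + 1 - 2 = n - 2 by omega, show n - 2 + 1 - 1 = n - 2 by omega]

/-- An integral corner-sum function violating only the lower bound on the row prefix sum
indexed by `(i, b)`. -/
lemma exists_cornerSum_lower {n i b : ℕ} (hn : 3 ≤ n) (h : (i, b) ∈ lowerIndex n) :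
    ∃ s : ℕ → ℕ → ℤ, IsSymmCornerSum n s ∧ s (i + 1) b - s i b < 0 ∧
      ∀ i' b', i' < n → b' ≤ n → (i', b') ≠ (i, b) →
        0 ≤ s (i' + 1) b' - s i' b' ∧ s (i' + 1) b' - s i' b' ≤ 1 := by
  rw [mem_lowerIndex] at h
  rcases h with ⟨rfl, rfl⟩ | h
  · refine ⟨fun a b => if a < 1 ∨ b < 1 then 0 else min (min a b) (a + b - 3),
      ⟨?_, ?_, ?_⟩, ?_, ?_⟩
    · intro a b
      split_ifs <;> omega
    · simp
    · intro a ha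
      split_ifs <;> omega
    · norm_num
    · intro i' b' hi hb hne
      rw [Ne, Prod.mk.injEq] at hne
      dsimp only
      split_ifs <;> omega
  · obtain ⟨d, hd⟩ : ∃ d : ℕ → ℕ → ℤ, ∀ x y, d x y = max 0 ((i : ℤ) + 1 + b - n) +
        max 0 ((x : ℤ) - (i + 1)) + max 0 ((y : ℤ) - b) +
        if (y = b ∧ x ≤ i) ∨ (i + 1 = b ∧ x ≤ b ∧ y ≤ i) then 1 else 0 := ⟨_, fun _ _ => rfl⟩
    have hrow : ∀ x y, (x, y) ≠ (i, b) → 0 ≤ d (x + 1) y - d x y ∧ d (x + 1) y - d x y ≤ 1 := by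
      intro x y hne
      rw [Ne, Prod.mk.injEq] at hne
      rw [hd, hd]
      split_ifs <;> omega
    have hcol : ∀ x y, (x, y) ≠ (i, b) → 0 ≤ d y (x + 1) - d y x ∧ d y (x + 1) - d y x ≤ 1 := by
      intro x y hne
      rw [Ne, Prod.mk.injEq] at hne
      rw [hd, hd]
      split_ifs <;> omega
    have hnonneg : ∀ x y, 0 ≤ d x y := by
      intro x y
      rw [hd]
      split_ifs <;> omega
    have hright : ∀ x, x ≤ n → x ≤ d x n ∧ x ≤ d n x := by
      intro x hx
      rw [hd, hd]
      split_ifs <;> omega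
    have htarget : d (i + 1) b = max 0 ((i : ℤ) + 1 + b - n) := by
      rw [hd]
      split_ifs <;> omega
    have hsource : max 0 ((i : ℤ) + 1 + b - n) + 1 ≤ d i b ∧
        max 0 ((i : ℤ) + 1 + b - n) + 1 ≤ d b i := by
      rw [hd, hd]
      split_ifs <;> omega
    refine ⟨fun x y => min (min x y) (min (d x y) (d y x)), ⟨?_, ?_, ?_⟩, ?_, ?_⟩
    · intro x y
      omega
    · intro y
      have := hnonneg 0 y
      have := hnonneg y 0
      omega
    · intro x hx
      have := hright x hx
      omega
    · dsimp only
      omega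
    · intro x y hx hy hne
      have := hrow x y hne
      have := hcol x y hne
      dsimp only
      omega

/-- An integral corner-sum function violating only the upper bound on the row prefix sum
indexed by `(i, b)`. -/
lemma exists_cornerSum_upper {n i b : ℕ} (hn : 3 ≤ n) (h : (i, b) ∈ upperIndex n) :
    ∃ s : ℕ → ℕ → ℤ, IsSymmCornerSum n s ∧ 1 < s (i + 1) b - s i b ∧
      (∀ i' b', (i', b') ∈ lowerIndex n → 0 ≤ s (i' + 1) b' - s i' b') ∧
      ∀ i' b', (i', b') ∈ upperIndex n → (i', b') ≠ (i, b) → s (i' + 1) b' - s i' b' ≤ 1 := by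
  by_cases h0 : i = 0
  · subst h0
    have hb : b = n - 1 := by
      rw [mem_upperIndex] at h
      omega
    subst hb
    refine ⟨fun a b => if a < 1 ∨ b < 1 then 0 else if n ≤ a ∨ n ≤ b ∨ (a = 1 ∧ b = 1)
      then min a b else max (min a b) 2, ⟨?_, ?_, ?_⟩, ?_, ?_, ?_⟩
    · intro a b
      split_ifs <;> omega
    · simp
    · intro a ha
      split_ifs <;> omega
    · dsimp only
      split_ifs <;> omega
    · intro i' b' hm
      rw [mem_lowerIndex] at hm
      dsimp only
      split_ifs <;> omega
    · intro i' b' hm hne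
      rw [Ne, Prod.mk.injEq] at hne
      rw [mem_upperIndex] at hm
      dsimp only
      split_ifs <;> omega
  · rw [mem_upperIndex] at h
    obtain ⟨s, hs, hneg, hall⟩ := exists_cornerSum_lower (i := n - 1 - i) (b := n - b) hn
      (mem_lowerIndex.2 (by omega))
    have hrefl : ∀ i' b', i' < n → b' ≤ n →
        s (n - (i' + 1)) (n - b') + ((i' + 1 : ℕ) : ℤ) + b' - n - (s (n - i') (n - b') + i' + b' - n)
          = 1 - (s (n - 1 - i' + 1) (n - b') - s (n - 1 - i') (n - b')) := by
      intro i' b' hi _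
      rw [show n - 1 - i' + 1 = n - i' by omega, show n - (i' + 1) = n - 1 - i' by omega]
      push_cast
      ring
    have hne' : ∀ i' b', i' < n → b' ≤ n → (i', b') ≠ (i, b) →
        (n - 1 - i', n - b') ≠ (n - 1 - i, n - b) := by
      intro i' b' hi hb hne
      rw [Ne, Prod.mk.injEq] at hne ⊢
      omega
    refine ⟨fun x y => if x ≤ n ∧ y ≤ n then s (n - x) (n - y) + x + y - n else 0,
      ⟨?_, ?_, ?_⟩, ?_, ?_, ?_⟩
    · intro x y
      rw [hs.symm]
      split_ifs <;> omega
    · intro y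
      split_ifs with hy
      · rw [hs.symm, Nat.sub_zero, hs.boundary _ (by omega)]
        omega
      · rfl
    · intro x hx
      rw [if_pos (by omega), Nat.sub_self, hs.symm, hs.zero]
      omega
    · dsimp only
      rw [if_pos (by omega), if_pos (by omega), hrefl _ _ (by omega) (by omega)]
      omega
    · intro i' b' hm
      rw [mem_lowerIndex] at hm
      dsimp only
      rw [if_pos (by omega), if_pos (by omega), hrefl _ _ (by omega) (by omega)]
      by_cases hne : (i', b') = (i, b)
      · rw [Prod.mk.injEq] at hne
        rw [hne.1, hne.2]
        omega
      · have := hall (n - 1 - i') (n - b') (by omega) (by omega)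
          (hne' _ _ (by omega) (by omega) hne)
        omega
    · intro i' b' hm hne
      rw [mem_upperIndex] at hm
      dsimp only
      rw [if_pos (by omega), if_pos (by omega), hrefl _ _ (by omega) (by omega)]
      have := hall (n - 1 - i') (n - b') (by omega) (by omega)
        (hne' _ _ (by omega) (by omega) hne)
      omega

end CornerSums

section RandomRounding

open MeasureTheory

lemma integrable_floor_add (y : ℝ) :
    Integrable (fun θ : ℝ => (⌊y + θ⌋ : ℝ)) (volume.restrict (Set.Ico 0 1)) := by
  refine Measure.integrableOn_of_bounded (M := |y| + 2) (by simp)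
    (Measurable.of_discrete.comp
      (Int.measurable_floor.comp (measurable_const_add y))).aestronglyMeasurable ?_
  filter_upwards [ae_restrict_mem measurableSet_Ico] with θ hθ
  have h1 := Int.floor_le (y + θ)
  have h2 := Int.lt_floor_add_one (y + θ)
  rw [Real.norm_eq_abs, abs_le]
  constructor <;> linarith [neg_abs_le y, le_abs_self y, hθ.1, hθ.2]

lemma integral_floor_add (y : ℝ) : ∫ θ in Set.Ico (0 : ℝ) 1, (⌊y + θ⌋ : ℝ) = y := by
  have hper : Function.Periodic (Int.fract : ℝ → ℝ) 1 := fun x => Int.fract_add_one x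
  have hfract : ∫ θ in (0 : ℝ)..1, Int.fract (y + θ) = 1 / 2 := by
    rw [intervalIntegral.integral_comp_add_left (fun θ => Int.fract θ), add_zero,
      hper.intervalIntegral_add_eq y 0, zero_add, intervalIntegral.integral_of_le zero_le_one,
      ← integral_Ico_eq_integral_Ioc,
      setIntegral_congr_fun (g := fun θ => θ) measurableSet_Ico
        fun θ hθ => Int.fract_eq_self.2 hθ,
      integral_Ico_eq_integral_Ioc, ← intervalIntegral.integral_of_le zero_le_one, integral_id]
    norm_num
  have hint : IntervalIntegrable (fun θ : ℝ => (⌊y + θ⌋ : ℝ)) volume 0 1 := by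
    rw [intervalIntegrable_iff_integrableOn_Ico_of_le zero_le_one]
    exact integrable_floor_add y
  rw [integral_Ico_eq_integral_Ioc, ← intervalIntegral.integral_of_le zero_le_one]
  have hsub : ∀ θ : ℝ, Int.fract (y + θ) = y + θ - ⌊y + θ⌋ := fun θ => rfl
  simp only [hsub] at hfract
  rw [intervalIntegral.integral_sub (Continuous.intervalIntegrable (by fun_prop) _ _) hint,
    intervalIntegral.integral_add (by simp) (by simp), integral_id] at hfract
  simp at hfract
  linarith

end RandomRounding

section CoreCoordinates

/-- The positions on or above the main diagonal of an `n × n` matrix. -/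
abbrev UpperTriangle (n : ℕ) : Type := {p : Fin n × Fin n // p.1 ≤ p.2}

/-- The `(i, j)` entry of the symmetric matrix with a given upper triangle (zero outside the
matrix). -/
def symmEntry (n i j : ℕ) : (UpperTriangle n → ℝ) →ₗ[ℝ] ℝ :=
  if h : max i j < n then
    LinearMap.proj ⟨(⟨min i j, min_le_max.trans_lt h⟩, ⟨max i j, h⟩),
      Fin.mk_le_mk.2 min_le_max⟩
  else 0

/-- The sum of the first `b` entries of row `i` of the symmetric matrix with a given upper
triangle. -/
def rowPrefix (n i b : ℕ) : (UpperTriangle n → ℝ) →ₗ[ℝ] ℝ :=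
  ∑ j ∈ Finset.range b, symmEntry n i j

/-- The sum of the leading `a × b` submatrix of the symmetric matrix with a given upper triangle. -/
def cornerSum (n : ℕ) (x : UpperTriangle n → ℝ) (a b : ℕ) : ℝ :=
  ∑ i ∈ Finset.range a, rowPrefix n i b x

/-- The upper triangle of the matrix with given corner sums. -/
def ofCornerSum (n : ℕ) (s : ℕ → ℕ → ℝ) : UpperTriangle n → ℝ := fun p =>
  s (p.1.1 + 1) (p.1.2 + 1) - s p.1.1 (p.1.2 + 1) - s (p.1.1 + 1) p.1.2 + s p.1.1 p.1.2

variable {n : ℕ}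

lemma symmEntry_comm (i j : ℕ) : symmEntry n i j = symmEntry n j i := by
  simp only [symmEntry, max_comm i j, min_comm i j]

lemma symmEntry_apply (p : UpperTriangle n) (x : UpperTriangle n → ℝ) :
    symmEntry n p.1.1 p.1.2 x = x p := by
  have hp : (p.1.1 : ℕ) ≤ p.1.2 := p.2
  rw [symmEntry, dif_pos (by rw [max_eq_right hp]; exact p.1.2.2)]
  simp [min_eq_left hp, max_eq_right hp]

lemma rowPrefix_succ (i b : ℕ) (x : UpperTriangle n → ℝ) :
    rowPrefix n i (b + 1) x = rowPrefix n i b x + symmEntry n i b x := by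
  simp [rowPrefix, Finset.sum_range_succ]

lemma symmEntry_ofCornerSum {s : ℕ → ℕ → ℝ} (hs : ∀ a b, s a b = s b a) {i j : ℕ} (hi : i < n)
    (hj : j < n) :
    symmEntry n i j (ofCornerSum n s) =
      s (i + 1) (j + 1) - s i (j + 1) - s (i + 1) j + s i j := by
  rcases le_total i j with h | h
  · exact symmEntry_apply ⟨(⟨i, hi⟩, ⟨j, hj⟩), h⟩ _
  · rw [symmEntry_comm]
    refine (symmEntry_apply ⟨(⟨j, hj⟩, ⟨i, hi⟩), h⟩ _).trans ?_
    simp only [ofCornerSum]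
    rw [hs (j + 1) (i + 1), hs j (i + 1), hs (j + 1) i, hs j i]
    ring

lemma rowPrefix_ofCornerSum {s : ℕ → ℕ → ℝ} (hs : IsSymmCornerSum n s) {i b : ℕ} (hi : i < n)
    (hb : b ≤ n) : rowPrefix n i b (ofCornerSum n s) = s (i + 1) b - s i b := by
  induction b with
  | zero => simp [rowPrefix, hs.symm _ 0, hs.zero]
  | succ b ih =>
    rw [rowPrefix_succ, ih (by omega), symmEntry_ofCornerSum hs.symm hi (by omega)]
    ring

lemma cornerSum_succ (x : UpperTriangle n → ℝ) (a b : ℕ) :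
    cornerSum n x (a + 1) b - cornerSum n x a b = rowPrefix n a b x := by
  simp [cornerSum, Finset.sum_range_succ]

lemma cornerSum_comm (x : UpperTriangle n → ℝ) (a b : ℕ) :
    cornerSum n x a b = cornerSum n x b a := by
  simp only [cornerSum, rowPrefix, LinearMap.sum_apply]
  rw [Finset.sum_comm]
  simp only [symmEntry_comm]

lemma ofCornerSum_cornerSum (x : UpperTriangle n → ℝ) : ofCornerSum n (cornerSum n x) = x := by
  ext p
  have h := rowPrefix_succ (n := n) p.1.1 p.1.2 x
  rw [symmEntry_apply, ← cornerSum_succ, ← cornerSum_succ] at h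
  simp only [ofCornerSum]
  linarith

/-- The affine space of upper triangles of symmetric matrices with unit row sums. -/
def unitRowSums (n : ℕ) : AffineSubspace ℝ (UpperTriangle n → ℝ) where
  carrier := {x | ∀ i, i < n → rowPrefix n i n x = 1}
  smul_vsub_vadd_mem' c x y z hx hy hz i hi := by
    simp [hx i hi, hy i hi, hz i hi]

lemma mem_unitRowSums {x : UpperTriangle n → ℝ} :
    x ∈ unitRowSums n ↔ ∀ i, i < n → rowPrefix n i n x = 1 := Iff.rfl

lemma isSymmCornerSum_cornerSum {x : UpperTriangle n → ℝ} (hx : x ∈ unitRowSums n) :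
    IsSymmCornerSum n (cornerSum n x) where
  symm := cornerSum_comm x
  zero b := by simp [cornerSum]
  boundary a ha := by
    rw [cornerSum, Finset.sum_congr rfl fun i hi =>
      mem_unitRowSums.1 hx i ((Finset.mem_range.1 hi).trans_le ha)]
    simp

lemma IsSymmCornerSum.intCast {t : ℕ → ℕ → ℤ} (ht : IsSymmCornerSum n t) :
    IsSymmCornerSum n fun a b => (t a b : ℝ) where
  symm a b := by rw [ht.symm]
  zero b := by simp [ht.zero]
  boundary a ha := by simp [ht.boundary a ha]

lemma ofCornerSum_mem_unitRowSums {s : ℕ → ℕ → ℝ} (hs : IsSymmCornerSum n s) :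
    ofCornerSum n s ∈ unitRowSums n := fun i hi => by
  rw [rowPrefix_ofCornerSum hs hi le_rfl, hs.boundary _ hi, hs.boundary _ hi.le]
  simp

/-- The irredundant inequalities of the core polytope. -/
def coreForm (n : ℕ) : lowerIndex n ⊕ upperIndex n → ((UpperTriangle n → ℝ) →ᵃ[ℝ] ℝ) :=
  Sum.elim (fun t => (rowPrefix n t.1.1 t.1.2).toAffineMap)
    fun t => AffineMap.const ℝ _ 1 - (rowPrefix n t.1.1 t.1.2).toAffineMap

@[simp] lemma coreForm_inl (t : lowerIndex n) (x : UpperTriangle n → ℝ) :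
    coreForm n (Sum.inl t) x = rowPrefix n t.1.1 t.1.2 x := rfl

@[simp] lemma coreForm_inr (t : upperIndex n) (x : UpperTriangle n → ℝ) :
    coreForm n (Sum.inr t) x = 1 - rowPrefix n t.1.1 t.1.2 x := rfl

lemma rowPrefix_mem_Icc_of_nonneg {x : UpperTriangle n → ℝ} {i b : ℕ}
    (hx : rowPrefix n i n x = 1) (h0 : ∀ j, j < n → 0 ≤ symmEntry n i j x) (hb : b ≤ n) :
    rowPrefix n i b x ∈ Set.Icc 0 1 := by
  rw [← hx]
  simp only [rowPrefix, LinearMap.sum_apply]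
  refine ⟨Finset.sum_nonneg fun j hj => h0 j ((Finset.mem_range.1 hj).trans_le hb),
    Finset.sum_le_sum_of_subset_of_nonneg (Finset.range_subset_range.2 hb) fun j hj _ =>
      h0 j (Finset.mem_range.1 hj)⟩

lemma symmEntry_le_one_of_nonneg {x : UpperTriangle n → ℝ} {i j : ℕ}
    (hx : rowPrefix n i n x = 1) (h0 : ∀ j, j < n → 0 ≤ symmEntry n i j x) (hj : j < n) :
    symmEntry n i j x ≤ 1 := by
  rw [← hx]
  simp only [rowPrefix, LinearMap.sum_apply]
  exact Finset.single_le_sum (f := fun j => symmEntry n i j x)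
    (fun j hj => h0 j (Finset.mem_range.1 hj)) (Finset.mem_range.2 hj)

lemma rowPrefix_mem_Icc (hn : 3 ≤ n) {x : UpperTriangle n → ℝ}
    (hx : x ∈ polyhedron (unitRowSums n) (coreForm n)) {i b : ℕ} (hi : i < n) (hb : b ≤ n) :
    rowPrefix n i b x ∈ Set.Icc 0 1 := by
  have hsum := mem_unitRowSums.1 hx.1
  have hlo : ∀ i b, (i, b) ∈ lowerIndex n → 0 ≤ rowPrefix n i b x := fun i b h =>
    hx.2 (Sum.inl ⟨(i, b), h⟩)
  have hup : ∀ i b, (i, b) ∈ upperIndex n → rowPrefix n i b x ≤ 1 := fun i b h => by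
    simpa using hx.2 (Sum.inr ⟨(i, b), h⟩)
  have hfirst : ∀ i, symmEntry n i 0 x = rowPrefix n i 1 x := fun i => by simp [rowPrefix]
  have hlast : ∀ i, i < n → symmEntry n i (n - 1) x = 1 - rowPrefix n i (n - 1) x := by
    intro i hi
    have h := rowPrefix_succ i (n - 1) x
    rw [Nat.sub_add_cancel (by omega), hsum i hi] at h
    linarith
  have htop : ∀ j, j < n → 0 ≤ symmEntry n 0 j x := by
    intro j hj
    rcases eq_or_ne j (n - 1) with rfl | hj'
    · rw [hlast 0 (by omega)]
      linarith [hup 0 (n - 1) (mem_upperIndex.2 (by omega))]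
    · rw [symmEntry_comm, hfirst]
      exact hlo j 1 (mem_lowerIndex.2 (by omega))
  have hbot : ∀ j, j < n → 0 ≤ symmEntry n (n - 1) j x := by
    intro j hj
    rw [symmEntry_comm, hlast j hj]
    linarith [hup j (n - 1) (mem_upperIndex.2 (by omega))]
  rcases eq_or_ne i 0 with rfl | hi0
  · exact rowPrefix_mem_Icc_of_nonneg (hsum 0 hi) htop hb
  rcases eq_or_ne i (n - 1) with rfl | hi1
  · exact rowPrefix_mem_Icc_of_nonneg (hsum (n - 1) hi) hbot hb
  rcases eq_or_ne b 0 with rfl | hb0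
  · simp [rowPrefix]
  rcases eq_or_ne b n with rfl | hbn
  · simp [hsum i hi]
  constructor
  · rcases eq_or_ne b (n - 1) with rfl | hb1
    · have h := symmEntry_le_one_of_nonneg (hsum (n - 1) (by omega)) hbot hi
      rw [symmEntry_comm, hlast i hi] at h
      linarith
    · exact hlo i b (mem_lowerIndex.2 (by omega))
  · rcases eq_or_ne b 1 with rfl | hb1
    · rw [← hfirst, symmEntry_comm]
      exact symmEntry_le_one_of_nonneg (hsum 0 (by omega)) htop hi
    · exact hup i b (mem_upperIndex.2 (by omega))

lemma mem_polyhedron_of_rowPrefix_mem_Icc (hn : 3 ≤ n) {x : UpperTriangle n → ℝ}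
    (hx : x ∈ unitRowSums n)
    (h : ∀ i b, i < n → b ≤ n → rowPrefix n i b x ∈ Set.Icc 0 1) :
    x ∈ polyhedron (unitRowSums n) (coreForm n) := by
  refine ⟨hx, ?_⟩
  rintro (⟨⟨i, b⟩, ht⟩ | ⟨⟨i, b⟩, ht⟩)
  · rw [mem_lowerIndex] at ht
    exact (h i b (by omega) (by omega)).1
  · rw [mem_upperIndex] at ht
    simpa using (h i b (by omega) (by omega)).2

end CoreCoordinates

section DSASM

/-- The upper triangles of the diagonally symmetric alternating sign matrices. -/
def dsasmTriangles (n : ℕ) : Set (UpperTriangle n → ℝ) :=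
  (fun (X : Fin n → Fin n → ℝ) (p : UpperTriangle n) => X p.1.1 p.1.2) ''
    {X | IsASM n X ∧ ∀ i j, X i j = X j i}

variable {n : ℕ}

lemma sum_Iic_fin_eq_sum_range (g : ℕ → ℝ) (j : Fin n) :
    ∑ k ∈ Finset.Iic j, g k = ∑ k ∈ Finset.range (j + 1), g k := by
  rw [Nat.range_succ_eq_Iic, ← Fin.map_valEmbedding_Iic, Finset.sum_map]
  rfl

lemma finite_dsasmTriangles : (dsasmTriangles n).Finite := by
  refine (Set.Finite.pi' (t := fun _ : UpperTriangle n => ({-1, 0, 1} : Set ℝ))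
    fun _ => Set.toFinite _).subset ?_
  rintro _ ⟨X, hX, rfl⟩ p
  exact hX.1.1 _ _

lemma symmEntry_upperTriangle {X : Fin n → Fin n → ℝ} (hX : ∀ i j, X i j = X j i) (i j : Fin n) :
    symmEntry n i j (fun p : UpperTriangle n => X p.1.1 p.1.2) = X i j := by
  rcases le_total i j with h | h
  · exact symmEntry_apply ⟨(i, j), h⟩ _
  · rw [symmEntry_comm, hX i j]
    exact symmEntry_apply ⟨(j, i), h⟩ _

lemma dsasmTriangles_subset (hn : 3 ≤ n) :
    dsasmTriangles n ⊆ polyhedron (unitRowSums n) (coreForm n) := by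
  rintro _ ⟨X, ⟨hX, hsymm⟩, rfl⟩
  have hrow : ∀ i j : Fin n, rowPrefix n i (j + 1) (fun p : UpperTriangle n => X p.1.1 p.1.2) =
      ∑ k ∈ Finset.Iic j, X i k := by
    intro i j
    simp only [rowPrefix, LinearMap.sum_apply]
    rw [← sum_Iic_fin_eq_sum_range
      (fun k => symmEntry n i k (fun p : UpperTriangle n => X p.1.1 p.1.2))]
    simp only [symmEntry_upperTriangle hsymm]
  refine mem_polyhedron_of_rowPrefix_mem_Icc hn (fun i hi => ?_) fun i b hi hb => ?_
  · simp only [rowPrefix, LinearMap.sum_apply]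
    rw [← Fin.sum_univ_eq_sum_range
      (fun k => symmEntry n i k (fun p : UpperTriangle n => X p.1.1 p.1.2)),
      ← hX.2.2.2.1 ⟨i, hi⟩]
    exact Finset.sum_congr rfl fun j _ => symmEntry_upperTriangle hsymm ⟨i, hi⟩ j
  · rcases b with _ | b
    · simp [rowPrefix]
    · rw [hrow ⟨i, hi⟩ ⟨b, hb⟩]
      rcases hX.2.1 ⟨i, hi⟩ ⟨b, hb⟩ with h | h <;> simp [h]

lemma ofCornerSum_mem_dsasmTriangles {t : ℕ → ℕ → ℤ} (ht : IsSymmCornerSum n t)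
    (hd : ∀ i b, i < n → b ≤ n → 0 ≤ t (i + 1) b - t i b ∧ t (i + 1) b - t i b ≤ 1) :
    ofCornerSum n (fun a b => (t a b : ℝ)) ∈ dsasmTriangles n := by
  set x := ofCornerSum n (fun a b => (t a b : ℝ)) with hx
  have hsum : ∀ i b, i < n → b ≤ n → rowPrefix n i b x = 0 ∨ rowPrefix n i b x = 1 := by
    intro i b hi hb
    rw [hx, rowPrefix_ofCornerSum ht.intCast hi hb]
    have h := hd i b hi hb
    have h' : t (i + 1) b - t i b = 0 ∨ t (i + 1) b - t i b = 1 := by omega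
    exact_mod_cast h'
  have hfull : ∀ i : Fin n, ∑ j : Fin n, symmEntry n i j x = 1 := by
    intro i
    rw [Fin.sum_univ_eq_sum_range (fun k => symmEntry n i k x)]
    have := ofCornerSum_mem_unitRowSums ht.intCast i i.2
    simpa only [rowPrefix, LinearMap.sum_apply] using this
  have hrow : ∀ i j : Fin n, ∑ k ∈ Finset.Iic j, symmEntry n i k x = 0 ∨
      ∑ k ∈ Finset.Iic j, symmEntry n i k x = 1 := by
    intro i j
    rw [sum_Iic_fin_eq_sum_range (fun k => symmEntry n i k x)]
    simpa only [rowPrefix, LinearMap.sum_apply] using hsum i (j + 1) i.2 j.2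
  refine ⟨fun i j => symmEntry n i j x,
    ⟨⟨fun i j => ?_, hrow, fun i j => ?_, hfull, fun j => ?_⟩, fun i j => ?_⟩, ?_⟩
  · have h := rowPrefix_succ (n := n) i j x
    rcases hsum i j i.2 j.2.le with h1 | h1 <;>
      rcases hsum i (j + 1) i.2 j.2 with h2 | h2 <;> rw [h1, h2] at h
    · right; left; linarith
    · right; right; linarith
    · left; linarith
    · right; left; linarith
  · simpa only [symmEntry_comm _ (j : ℕ)] using hrow j i
  · simpa only [symmEntry_comm _ (j : ℕ)] using hfull j
  · dsimp only
    rw [symmEntry_comm]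
  · ext p
    exact symmEntry_apply p x

open MeasureTheory in
lemma mem_convexHull_dsasmTriangles {x : UpperTriangle n → ℝ} (hx : x ∈ unitRowSums n)
    (h : ∀ i b, i < n → b ≤ n → rowPrefix n i b x ∈ Set.Icc 0 1) :
    x ∈ convexHull ℝ (dsasmTriangles n) := by
  have hs := isSymmCornerSum_cornerSum hx
  have : IsProbabilityMeasure (volume.restrict (Set.Ico (0 : ℝ) 1)) := ⟨by simp⟩
  have hint : ∀ p, Integrable
      (fun θ : ℝ => ofCornerSum n (fun a b => (⌊cornerSum n x a b + θ⌋ : ℝ)) p)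
      (volume.restrict (Set.Ico 0 1)) := fun p =>
    (((integrable_floor_add _).sub (integrable_floor_add _)).sub
      (integrable_floor_add _)).add (integrable_floor_add _)
  have hmem := Convex.integral_mem (μ := volume.restrict (Set.Ico (0 : ℝ) 1))
    (f := fun θ => ofCornerSum n (fun a b => (⌊cornerSum n x a b + θ⌋ : ℝ)))
    (convex_convexHull ℝ (dsasmTriangles n)) (finite_dsasmTriangles.isClosed_convexHull ℝ)
    (by
      filter_upwards [ae_restrict_mem measurableSet_Ico] with θ hθ
      refine subset_convexHull ℝ _ (ofCornerSum_mem_dsasmTriangles ⟨?_, ?_, ?_⟩ ?_)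
      · intro a b
        rw [cornerSum_comm]
      · intro b
        rw [hs.zero, zero_add]
        exact Int.floor_eq_zero_iff.2 hθ
      · intro a ha
        rw [hs.boundary a ha, Int.floor_natCast_add, Int.floor_eq_zero_iff.2 hθ, add_zero]
      · intro i b hi hb
        have hR := h i b hi hb
        rw [← cornerSum_succ] at hR
        have h1 : ⌊cornerSum n x i b + θ⌋ ≤ ⌊cornerSum n x (i + 1) b + θ⌋ :=
          Int.floor_le_floor (by linarith [hR.1])
        have h2 : ⌊cornerSum n x (i + 1) b + θ⌋ ≤ ⌊cornerSum n x i b + θ + 1⌋ :=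
          Int.floor_le_floor (by linarith [hR.2])
        rw [Int.floor_add_one] at h2
        omega)
    (Integrable.of_eval hint)
  convert hmem using 1
  ext p
  rw [eval_integral hint]
  simp only [ofCornerSum]
  have hi := fun a b => integrable_floor_add (cornerSum n x a b)
  rw [integral_add (Integrable.sub' (Integrable.sub' (hi _ _) (hi _ _)) (hi _ _)) (hi _ _),
    integral_sub (Integrable.sub' (hi _ _) (hi _ _)) (hi _ _),
    integral_sub (hi _ _) (hi _ _)]
  simp only [integral_floor_add]
  exact (congrFun (ofCornerSum_cornerSum x) p).symm

lemma convexHull_dsasmTriangles (hn : 3 ≤ n) :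
    convexHull ℝ (dsasmTriangles n) = polyhedron (unitRowSums n) (coreForm n) :=
  Set.Subset.antisymm (convexHull_min (dsasmTriangles_subset hn) convex_polyhedron) fun _ hx =>
    mem_convexHull_dsasmTriangles hx.1 fun _ _ => rowPrefix_mem_Icc hn hx

lemma exists_interior_point (hn : 3 ≤ n) :
    ∃ o ∈ unitRowSums n, ∀ k, 0 < coreForm n k o := by
  have hn0 : (0 : ℝ) < n := by exact_mod_cast (by omega : 0 < n)
  have hs : IsSymmCornerSum n fun a b => (a * b / n : ℝ) :=
    ⟨fun a b => by ring, by simp, fun a _ => by field_simp⟩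
  have hrow : ∀ i b, i < n → b ≤ n →
      rowPrefix n i b (ofCornerSum n fun a b => (a * b / n : ℝ)) = b / n := by
    intro i b hi hb
    rw [rowPrefix_ofCornerSum hs hi hb]
    push_cast
    ring
  refine ⟨_, ofCornerSum_mem_unitRowSums hs, ?_⟩
  rintro (⟨⟨i, b⟩, ht⟩ | ⟨⟨i, b⟩, ht⟩)
  · rw [mem_lowerIndex] at ht
    rw [coreForm_inl, hrow i b (by omega) (by omega)]
    have : (0 : ℝ) < b := by exact_mod_cast (by omega : 0 < b)
    positivity
  · rw [mem_upperIndex] at ht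
    rw [coreForm_inr, hrow i b (by omega) (by omega), sub_pos, div_lt_one hn0]
    exact_mod_cast (by omega : b < n)

lemma coreForm_irredundant (hn : 3 ≤ n) (k : lowerIndex n ⊕ upperIndex n) :
    ∃ q ∈ unitRowSums n, coreForm n k q < 0 ∧ ∀ j, j ≠ k → 0 ≤ coreForm n j q := by
  have hlow : ∀ i b, (i, b) ∈ lowerIndex n → i < n ∧ b ≤ n := fun i b h => by
    rw [mem_lowerIndex] at h
    omega
  have hupp : ∀ i b, (i, b) ∈ upperIndex n → i < n ∧ b ≤ n := fun i b h => by
    rw [mem_upperIndex] at h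
    omega
  rcases k with ⟨⟨i, b⟩, hk⟩ | ⟨⟨i, b⟩, hk⟩
  · obtain ⟨s, hs, hneg, hall⟩ := exists_cornerSum_lower hn hk
    have hrow := fun {i b} => rowPrefix_ofCornerSum (i := i) (b := b) hs.intCast
    refine ⟨_, ofCornerSum_mem_unitRowSums hs.intCast, ?_, ?_⟩
    · rw [coreForm_inl, hrow (hlow i b hk).1 (hlow i b hk).2]
      exact_mod_cast hneg
    · rintro (⟨⟨i', b'⟩, hj⟩ | ⟨⟨i', b'⟩, hj⟩) hne
      · rw [coreForm_inl, hrow (hlow i' b' hj).1 (hlow i' b' hj).2]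
        have h := (hall i' b' (hlow i' b' hj).1 (hlow i' b' hj).2 fun h => hne (by simp_all)).1
        exact_mod_cast h
      · rw [coreForm_inr, hrow (hupp i' b' hj).1 (hupp i' b' hj).2, sub_nonneg]
        have h : s (i' + 1) b' - s i' b' ≤ 1 := by
          by_cases he : (i', b') = (i, b)
          · rw [Prod.mk.injEq] at he
            rw [he.1, he.2]
            omega
          · exact (hall i' b' (hupp i' b' hj).1 (hupp i' b' hj).2 he).2
        exact_mod_cast h
  · obtain ⟨s, hs, hgt, hlo, hup⟩ := exists_cornerSum_upper hn hk
    have hrow := fun {i b} => rowPrefix_ofCornerSum (i := i) (b := b) hs.intCast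
    refine ⟨_, ofCornerSum_mem_unitRowSums hs.intCast, ?_, ?_⟩
    · rw [coreForm_inr, hrow (hupp i b hk).1 (hupp i b hk).2, sub_neg]
      exact_mod_cast hgt
    · rintro (⟨⟨i', b'⟩, hj⟩ | ⟨⟨i', b'⟩, hj⟩) hne
      · rw [coreForm_inl, hrow (hlow i' b' hj).1 (hlow i' b' hj).2]
        exact_mod_cast hlo i' b' hj
      · rw [coreForm_inr, hrow (hupp i' b' hj).1 (hupp i' b' hj).2, sub_nonneg]
        have h := hup i' b' hj fun h => hne (by simp_all)
        exact_mod_cast h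

end DSASM

/-- For `n ≥ 3`, the core polytope of diagonally symmetric ASMs (the convex hull
of the upper-triangular parts of DSASMs) has exactly `2(n-2)² + 3` facets. -/
theorem DSASM_core_polytope_facets (n : ℕ) (hn : 3 ≤ n) :
    {F : Set ({p : Fin n × Fin n // p.1 ≤ p.2} → ℝ) |
        IsFacetOf
          (convexHull ℝ
            ((fun (X : Fin n → Fin n → ℝ) (p : {p : Fin n × Fin n // p.1 ≤ p.2}) =>
                X p.1.1 p.1.2) ''
              {X | IsASM n X ∧ ∀ i j, X i j = X j i})) F}.ncard
      = 2 * (n - 2) ^ 2 + 3 := by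
  change {F | IsFacetOf (convexHull ℝ (dsasmTriangles n)) F}.ncard = _
  obtain ⟨o, ho, hpos⟩ := exists_interior_point hn
  rw [convexHull_dsasmTriangles hn, ncard_facets_polyhedron ho hpos (coreForm_irredundant hn),
    Nat.card_eq_fintype_card, Fintype.card_sum, Fintype.card_coe, Fintype.card_coe,
    card_lowerIndex, card_upperIndex hn]
  ring
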